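/- arXiv:2207.03094 — 4 statements merged into one kernel-verified Lean document; each statement's English description precedes it below -/
import Mathlib

section
/- Let h : ℝ → ℝ be a nonnegative, twice continuously differentiable function with compact support which is not identically zero. Then for every x ∈ ℝ with h(x) > 0 one has h'(x)² / h(x) ≤ 2 · sup_{y ∈ ℝ} |h''(y)|. -/
open MeasureTheory Real Filter Set

/-- For a nonnegative, C², compactly supported function `h : ℝ → ℝ`
(not identically zero), at every point where `h x > 0` one has
`(h' x)² / h x ≤ 2 * sup_y |h'' y|`. -/
theorem stmt0 (h : ℝ → ℝ) (hne : h ≠ 0) (hnonneg : ∀ x : ℝ, 0 ≤ h x)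
    (hsmooth : ContDiff ℝ 2 h) (hsupp : HasCompactSupport h) :
    ∀ x : ℝ, 0 < h x →
      (deriv h x) ^ 2 / h x ≤ 2 * ⨆ y : ℝ, |deriv (deriv h) y| := by
  intro x hx
  have h1 : Differentiable ℝ h := hsmooth.differentiable (by norm_num)
  have hs1 : ContDiff ℝ 1 (deriv h) :=
    ((contDiff_succ_iff_deriv (n := 1)).1 (by norm_num; exact hsmooth)).2.2
  have h2 : Differentiable ℝ (deriv h) := hs1.differentiable (by norm_num)
  have hc : Continuous (deriv (deriv h)) := hs1.continuous_deriv (by norm_num)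
  have hbdd : BddAbove (range fun y => |deriv (deriv h) y|) := by
    obtain ⟨C, hC⟩ := hsupp.deriv.deriv.exists_bound_of_continuous hc
    refine ⟨C, ?_⟩
    rintro _ ⟨y, rfl⟩
    exact hC y
  set M := ⨆ y : ℝ, |deriv (deriv h) y| with hM
  have hle : ∀ y, deriv (deriv h) y ≤ M := fun y => (le_abs_self _).trans (le_ciSup hbdd y)
  have d1 : ∀ y, HasDerivAt (fun y => M / 2 * y ^ 2 - h y) (M * y - deriv h y) y := by
    intro y
    have := (((hasDerivAt_id y).pow 2).const_mul (M / 2)).sub (h1 y).hasDerivAt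
    refine HasDerivAt.congr_deriv (f := fun y => M / 2 * y ^ 2 - h y) this ?_
    simp; ring
  have d2 : ∀ y, HasDerivAt (fun y => M * y - deriv h y) (M - deriv (deriv h) y) y := by
    intro y
    have := ((hasDerivAt_id y).const_mul M).sub (h2 y).hasDerivAt
    refine HasDerivAt.congr_deriv (f := fun y => M * y - deriv h y) this ?_
    simp
  have e1 : deriv (fun y => M / 2 * y ^ 2 - h y) = fun y => M * y - deriv h y :=
    funext fun y => (d1 y).deriv
  have hmono : Monotone (deriv (fun y => M / 2 * y ^ 2 - h y)) := by
    rw [e1]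
    refine monotone_of_deriv_nonneg (fun y => (d2 y).differentiableAt) fun y => ?_
    rw [(d2 y).deriv]; linarith [hle y]
  have hconv : ConvexOn ℝ univ (fun y => M / 2 * y ^ 2 - h y) :=
    hmono.convexOn_univ_of_deriv (fun y => (d1 y).differentiableAt)
  have key : ∀ t : ℝ, 0 ≤ M / 2 * (t * t) + deriv h x * t + h x := by
    intro t
    have hn := hnonneg (x + t)
    rcases lt_trichotomy t 0 with ht | ht | ht
    · have := hconv.slope_le_of_hasDerivAt (mem_univ (x + t)) (mem_univ x) (by linarith) (d1 x)
      rw [slope_def_field, div_le_iff₀ (by linarith)] at this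
      nlinarith
    · subst ht; simp; exact hx.le
    · have := hconv.le_slope_of_hasDerivAt (mem_univ x) (mem_univ (x + t)) (by linarith) (d1 x)
      rw [slope_def_field, le_div_iff₀ (by linarith)] at this
      nlinarith
  have := discrim_le_zero key
  rw [discrim] at this
  rw [div_le_iff₀ hx]
  linarith
end

section
/- Fix θ > 0 and set α = 1/(2+θ). For every t > 0 and every x ≠ 0 the kernel p^θ satisfies the degenerate heat equation ∂_t p^θ_t(x) = (2/(2+θ)²) · ∂_x ( |x|^{−θ} ∂_x p^θ_t(x) ). More precisely: the map s ↦ p^θ_s(x) is differentiable at t; the map y ↦ p^θ_t(y) is differentiable on a neighbourhood of x; the map y ↦ |y|^{−θ} ∂_y p^θ_t(y) is differentiable at x; and its derivative at x equals ((2+θ)²/2) times the time derivative ∂_t p^θ_t(x). -/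
open MeasureTheory Real Filter Set

/-- For `θ > 0`, `α = 1/(2+θ)`, `c_θ = (∫ exp(-|y|^(2+θ)/2) dy)⁻¹`, and the
kernel `p^θ_t(x) = c_θ t^(-α) exp(-|x|^(2+θ)/(2t))`, for every `t > 0` and `x ≠ 0`:
the map `s ↦ p^θ_s(x)` is differentiable at `t` with some derivative `dt`; the map
`y ↦ p^θ_t(y)` is differentiable on a neighbourhood of `x`; and the map
`y ↦ |y|^(-θ) ∂_y p^θ_t(y)` is differentiable at `x` with derivative `((2+θ)²/2) · dt`,
i.e. `∂_t p^θ_t(x) = (2/(2+θ)²) ∂_x(|x|^(-θ) ∂_x p^θ_t(x))`. -/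
theorem stmt3 (θ : ℝ) (hθ : 0 < θ) (c : ℝ)
    (hc : c = (∫ y : ℝ, Real.exp (-(|y| ^ (2 + θ)) / 2))⁻¹)
    (t x : ℝ) (ht : 0 < t) (hx : x ≠ 0) :
    ∃ dt : ℝ,
      HasDerivAt (fun s : ℝ => c * s ^ (-(1 / (2 + θ))) * Real.exp (-(|x| ^ (2 + θ)) / (2 * s)))
        dt t ∧
      (∀ᶠ y in nhds x,
        DifferentiableAt ℝ
          (fun z : ℝ => c * t ^ (-(1 / (2 + θ))) * Real.exp (-(|z| ^ (2 + θ)) / (2 * t))) y) ∧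
      HasDerivAt
        (fun y : ℝ => |y| ^ (-θ) *
          deriv (fun z : ℝ => c * t ^ (-(1 / (2 + θ))) * Real.exp (-(|z| ^ (2 + θ)) / (2 * t))) y)
        (((2 + θ) ^ 2 / 2) * dt) x := by
  clear hc
  have hb : (0:ℝ) < 2 + θ := by linarith
  have hD : ∀ K y : ℝ, HasDerivAt (fun z : ℝ => K * Real.exp (-(|z| ^ (2 + θ)) / (2 * t)))
      (K * (Real.exp (-(|y| ^ (2 + θ)) / (2 * t)) * (-((2 + θ) * |y| ^ θ * y) / (2 * t)))) y := by
    intro K y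
    have h := hasDerivAt_abs_rpow y (p := 2 + θ) (by linarith)
    rw [show 2 + θ - 2 = θ by ring] at h
    exact ((h.neg.div_const (2 * t)).exp).const_mul K
  have hxa : 0 < |x| := abs_pos.mpr hx
  have hpow : |x| ^ (2 + θ) = x * x * |x| ^ θ := by
    rw [Real.rpow_add hxa, Real.rpow_two, sq_abs]; ring
  have ht1 : HasDerivAt (fun s : ℝ => s ^ (-(1 / (2 + θ))))
      (-(1 / (2 + θ)) * (t ^ (-(1 / (2 + θ))) / t)) t := by
    have h := Real.hasDerivAt_rpow_const (x := t) (p := -(1 / (2 + θ))) (Or.inl ht.ne')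
    rwa [Real.rpow_sub_one ht.ne'] at h
  have ht2 : HasDerivAt (fun s : ℝ => -(|x| ^ (2 + θ)) / (2 * s))
      (|x| ^ (2 + θ) / (2 * t ^ 2)) t := by
    have h := (hasDerivAt_const t (-(|x| ^ (2 + θ)))).div ((hasDerivAt_id t).const_mul 2)
      (by simpa using ht.ne')
    refine h.congr_deriv ?_
    simp only [id]
    field_simp
    ring
  refine ⟨_, (ht1.const_mul c).mul ht2.exp, Eventually.of_forall fun y => (hD _ y).differentiableAt, ?_⟩
  generalize t ^ (-(1 / (2 + θ))) = T
  have h := (((hasDerivAt_id x).mul (hD 1 x))).const_mul (-(c * T * (2 + θ) / (2 * t)))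
  refine (h.congr_of_eventuallyEq ?_).congr_deriv ?_
  · filter_upwards [isOpen_ne.mem_nhds hx] with y hy
    rw [(hD (c * T) y).deriv, Real.rpow_neg (abs_nonneg y)]
    have : |y| ^ θ ≠ 0 := (Real.rpow_pos_of_pos (abs_pos.mpr hy) θ).ne'
    simp only [Pi.mul_apply, id]
    field_simp
  · simp only [id]
    generalize Real.exp (-(|x| ^ (2 + θ)) / (2 * t)) = e
    rw [hpow]
    field_simp
    ring
end

section
/- Let α ∈ [1/4, 1/2) and T > 0. There exists a constant C > 0, depending only on α and T, such that for all t ∈ [0,T] and all θ ∈ (0,1], ∫_0^t ( (t−s)^{−α} − (t+θ−s)^{−α} )² ds ≤ C θ^{1/2−α}. -/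
open MeasureTheory Real Filter Set

/-- For `α ∈ [1/4,1/2)` and `T > 0` there is a constant `C > 0` (depending
only on `α, T`) such that for all `t ∈ [0,T]` and `θ ∈ (0,1]`,
`∫_0^t ((t-s)^(-α) - (t+θ-s)^(-α))² ds ≤ C θ^(1/2-α)`. -/
theorem stmt10 (α T : ℝ) (hα : α ∈ Set.Ico (1 / 4 : ℝ) (1 / 2)) (hT : 0 < T) :
    ∃ C : ℝ, 0 < C ∧ ∀ t ∈ Set.Icc (0 : ℝ) T, ∀ θ ∈ Set.Ioc (0 : ℝ) 1,
      (∫ s in Set.Ioc (0 : ℝ) t, ((t - s) ^ (-α) - (t + θ - s) ^ (-α)) ^ 2)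
        ≤ C * θ ^ (1 / 2 - α) := by
  obtain ⟨h1, h2⟩ := hα
  have hc : 0 < 1 - 2 * α := by linarith
  refine ⟨1 / (1 - 2 * α), by positivity, ?_⟩
  rintro t ⟨ht0, htT⟩ θ ⟨hθ0, hθ1⟩
  have hr : (-1 : ℝ) < -(2 * α) := by linarith
  have i1 : IntervalIntegrable (fun s : ℝ => (t - s) ^ (-(2 * α))) volume 0 t := by
    have h := (intervalIntegral.intervalIntegrable_rpow' (a := 0) (b := t) hr).comp_sub_left t
    simpa using h.symm
  have i2 : IntervalIntegrable (fun s : ℝ => (t + θ - s) ^ (-(2 * α))) volume 0 t := by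
    have h := (intervalIntegral.intervalIntegrable_rpow' (a := θ) (b := t + θ) hr).comp_sub_left
      (t + θ)
    simpa using h.symm
  have key : (∫ s in Set.Ioc (0 : ℝ) t, ((t - s) ^ (-α) - (t + θ - s) ^ (-α)) ^ 2)
      ≤ ∫ s in Set.Ioc (0 : ℝ) t, ((t - s) ^ (-(2 * α)) - (t + θ - s) ^ (-(2 * α))) := by
    refine integral_mono_of_nonneg (Eventually.of_forall fun s => sq_nonneg _) ?_ ?_
    · exact ((intervalIntegrable_iff_integrableOn_Ioc_of_le ht0).1 (i1.sub i2))
    · have hne : ∀ᵐ s ∂(volume.restrict (Set.Ioc (0 : ℝ) t)), s ≠ t :=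
        ae_restrict_of_ae (Measure.ae_ne volume t)
      filter_upwards [hne, ae_restrict_mem measurableSet_Ioc] with s hs hs'
      have hp : 0 < t - s := sub_pos.2 (lt_of_le_of_ne hs'.2 hs)
      have hq : 0 < t + θ - s := by linarith
      have e : ∀ x : ℝ, 0 < x → x ^ (-(2 * α)) = (x ^ (-α)) ^ 2 := by
        intro x hx
        rw [← Real.rpow_natCast, ← Real.rpow_mul hx.le]
        congr 1
        push_cast
        ring
      simp only [e _ hp, e _ hq]
      have hb : 0 < (t + θ - s) ^ (-α) := Real.rpow_pos_of_pos hq _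
      have hab : (t + θ - s) ^ (-α) ≤ (t - s) ^ (-α) :=
        Real.rpow_le_rpow_of_nonpos hp (by linarith) (by linarith)
      nlinarith
  refine key.trans ?_
  rw [← intervalIntegral.integral_of_le ht0, intervalIntegral.integral_sub i1 i2,
    intervalIntegral.integral_comp_sub_left (fun x : ℝ => x ^ (-(2 * α))) t,
    intervalIntegral.integral_comp_sub_left (fun x : ℝ => x ^ (-(2 * α))) (t + θ),
    integral_rpow (Or.inl hr), integral_rpow (Or.inl hr)]
  have e1 : -(2 * α) + 1 = 1 - 2 * α := by ring
  have e2 : t + θ - t = θ := by ring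
  rw [e1, e2, sub_self, sub_zero, sub_zero, Real.zero_rpow hc.ne', ← sub_div, div_mul_eq_mul_div,
    one_mul]
  have m1 : t ^ (1 - 2 * α) ≤ (t + θ) ^ (1 - 2 * α) :=
    Real.rpow_le_rpow ht0 (by linarith) hc.le
  have m2 : θ ^ (1 - 2 * α) ≤ θ ^ (1 / 2 - α) :=
    Real.rpow_le_rpow_of_exponent_ge hθ0 hθ1 (by linarith)
  exact div_le_div_of_nonneg_right (by linarith) hc.le
end

section
/- Let 0 < a < b and let ψ : ℝ → ℝ be continuous and nonnegative with ψ(z) = 0 for z ∉ (a,b) and ∫_0^∞ ψ(z) dz = 1. Define φ(x) := ∫_0^{|x|} ( ∫_0^y ψ(z) dz ) dy for x ∈ ℝ. Then φ is twice differentiable on all of ℝ with φ'(x) = sgn(x) ∫_0^{|x|} ψ(y) dy and φ''(x) = ψ(|x|); moreover |φ'(x)| ≤ 1, 0 ≤ |x| − φ(x) ≤ b, and 0 ≤ |x| − x φ'(x) ≤ b for all x ∈ ℝ. -/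
open MeasureTheory Real Filter Set

/-- For `0 < a < b` and a continuous nonnegative `ψ` supported in `(a,b)`
with `∫_0^∞ ψ = 1`, the function `φ(x) = ∫_0^{|x|} ∫_0^y ψ(z) dz dy` is twice differentiable
with `φ'(x) = sgn(x) ∫_0^{|x|} ψ` and `φ''(x) = ψ(|x|)`; moreover `|φ'(x)| ≤ 1`,
`0 ≤ |x| - φ(x) ≤ b` and `0 ≤ |x| - x φ'(x) ≤ b` for all `x`. -/
theorem stmt13 (a b : ℝ) (ha : 0 < a) (hab : a < b)
    (ψ : ℝ → ℝ) (hψc : Continuous ψ) (hψ0 : ∀ z : ℝ, 0 ≤ ψ z)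
    (hψsupp : ∀ z : ℝ, z ∉ Set.Ioo a b → ψ z = 0)
    (hψint : (∫ z in Set.Ioi (0 : ℝ), ψ z) = 1)
    (φ : ℝ → ℝ)
    (hφ : ∀ x : ℝ, φ x = ∫ y in Set.Ioc (0 : ℝ) (|x|), ∫ z in Set.Ioc (0 : ℝ) y, ψ z) :
    (∀ x : ℝ, HasDerivAt φ (Real.sign x * ∫ y in Set.Ioc (0 : ℝ) (|x|), ψ y) x) ∧
    (∀ x : ℝ,
      HasDerivAt (fun u : ℝ => Real.sign u * ∫ y in Set.Ioc (0 : ℝ) (|u|), ψ y)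
        (ψ (|x|)) x) ∧
    (∀ x : ℝ, |Real.sign x * ∫ y in Set.Ioc (0 : ℝ) (|x|), ψ y| ≤ 1) ∧
    (∀ x : ℝ, 0 ≤ |x| - φ x ∧ |x| - φ x ≤ b) ∧
    (∀ x : ℝ,
      0 ≤ |x| - x * (Real.sign x * ∫ y in Set.Ioc (0 : ℝ) (|x|), ψ y) ∧
      |x| - x * (Real.sign x * ∫ y in Set.Ioc (0 : ℝ) (|x|), ψ y) ≤ b) := by
  have hi : ∀ u v, IntervalIntegrable ψ volume u v := fun u v => hψc.intervalIntegrable u v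
  obtain ⟨F, hF⟩ : ∃ F : ℝ → ℝ, ∀ y, F y = ∫ z in (0:ℝ)..y, ψ z := ⟨_, fun _ => rfl⟩
  have hFset : ∀ y, 0 ≤ y → (∫ z in Set.Ioc (0:ℝ) y, ψ z) = F y := fun y hy => by
    rw [hF, intervalIntegral.integral_of_le hy]
  have hFd : ∀ y, HasDerivAt F (ψ y) y := fun y => by
    rw [show F = fun y => ∫ z in (0:ℝ)..y, ψ z from funext hF]
    exact intervalIntegral.integral_hasDerivAt_right (hi _ _)
      (hψc.stronglyMeasurableAtFilter _ _) hψc.continuousAt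
  have hFc : Continuous F := continuous_iff_continuousAt.2 fun y => (hFd y).continuousAt
  have hFm : Monotone F := monotone_of_hasDerivAt_nonneg hFd hψ0
  have hF0 : ∀ y, y ≤ a → F y = 0 := fun y hy => by
    rw [hF]
    have : ∀ z ∈ Set.uIcc 0 y, ψ z = 0 := fun z hz => by
      apply hψsupp
      intro h
      have := (Set.mem_uIcc.1 hz)
      rcases this with h1 | h1 <;> linarith [h.1, h1.1, h1.2]
    rw [intervalIntegral.integral_congr (g := fun _ => 0) this]
    simp
  have hF1 : ∀ y, b ≤ y → F y = 1 := fun y hy => by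
    rw [← hFset y (by linarith), ← hψint]
    symm
    apply setIntegral_eq_of_subset_of_forall_sdiff_eq_zero measurableSet_Ioi
    · exact fun z hz => hz.1
    · intro z hz
      apply hψsupp
      intro h
      exact hz.2 ⟨hz.1, by linarith [h.2]⟩
  have hFle : ∀ y, F y ≤ 1 := fun y => by
    rw [← hF1 (max y b) (le_max_right _ _)]
    exact hFm (le_max_left _ _)
  have hFnn : ∀ y, 0 ≤ F y := fun y => by
    rw [← hF0 (min y a) (min_le_right _ _)]
    exact hFm (min_le_left _ _)
  obtain ⟨G, hG⟩ : ∃ G : ℝ → ℝ, ∀ y, G y = ∫ z in (0:ℝ)..y, F z := ⟨_, fun _ => rfl⟩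
  have hGd : ∀ y, HasDerivAt G (F y) y := fun y => by
    rw [show G = fun y => ∫ z in (0:ℝ)..y, F z from funext hG]
    exact intervalIntegral.integral_hasDerivAt_right (hFc.intervalIntegrable _ _)
      (hFc.stronglyMeasurableAtFilter _ _) hFc.continuousAt
  have hGm : Monotone G := monotone_of_hasDerivAt_nonneg hGd hFnn
  have hG0 : G 0 = 0 := by simp [hG]
  have hGneg : ∀ y, y ≤ 0 → G y = 0 := fun y hy => by
    rw [hG]
    have : ∀ z ∈ Set.uIcc 0 y, F z = 0 := fun z hz => by
      apply hF0
      rcases Set.mem_uIcc.1 hz with h1 | h1 <;> linarith [h1.1, h1.2]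
    rw [intervalIntegral.integral_congr (g := fun _ => 0) this]
    simp
  have hHm : Monotone (fun y => y - G y) :=
    monotone_of_hasDerivAt_nonneg (fun y => (hasDerivAt_id y).sub (hGd y))
      (fun y => sub_nonneg.2 (hFle y))
  have hφG : ∀ x, φ x = G |x| := fun x => by
    rw [hφ, hG, intervalIntegral.integral_of_le (abs_nonneg x)]
    exact setIntegral_congr_fun measurableSet_Ioc fun y hy => hFset y hy.1.le
  have hφe : φ = fun x => G x + G (-x) := funext fun x => by
    rw [hφG]
    rcases le_total 0 x with h | h
    · rw [abs_of_nonneg h, hGneg (-x) (by linarith), add_zero]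
    · rw [abs_of_nonpos h, hGneg x h, zero_add]
  have hs : ∀ x, Real.sign x * (∫ y in Set.Ioc (0 : ℝ) (|x|), ψ y) = F x - F (-x) := fun x => by
    rw [hFset _ (abs_nonneg x)]
    rcases lt_trichotomy x 0 with h | h | h
    · rw [Real.sign_of_neg h, abs_of_neg h, hF0 x (by linarith)]; ring
    · simp [h]
    · rw [Real.sign_of_pos h, abs_of_pos h, hF0 (-x) (by linarith)]; ring
  have hx : ∀ x, x * (F x - F (-x)) = |x| * F |x| := fun x => by
    rcases le_total 0 x with h | h
    · rw [abs_of_nonneg h, hF0 (-x) (by linarith), sub_zero]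
    · rw [abs_of_nonpos h, hF0 x (by linarith)]; ring
  have hneg : ∀ x : ℝ, HasDerivAt (fun u : ℝ => -u) (-1) x := fun x => hasDerivAt_neg x
  simp only [hs, hx]
  refine ⟨fun x => ?_, fun x => ?_, fun x => ?_, fun x => ?_, fun x => ?_⟩
  · rw [hφe]
    have := (hGd x).add ((hGd (-x)).comp x (hneg x))
    exact this.congr_deriv (by ring)
  · have := (hFd x).sub ((hFd (-x)).comp x (hneg x))
    refine HasDerivAt.congr_deriv this ?_
    rcases le_total 0 x with h | h
    · rw [abs_of_nonneg h, hψsupp (-x) (fun k => by linarith [k.1])]; ring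
    · rw [abs_of_nonpos h, hψsupp x (fun k => by linarith [k.1])]; ring
  · rw [abs_le]
    constructor <;> linarith [hFle x, hFle (-x), hFnn x, hFnn (-x)]
  · rw [hφG]
    have h0 := hHm (abs_nonneg x)
    simp only [hG0] at h0
    refine ⟨by linarith, ?_⟩
    rcases le_total |x| b with h | h
    · have := hGm (abs_nonneg x)
      linarith
    · have h2 : G |x| = G b + (|x| - b) := by
        have h3 : (∫ z in b..|x|, F z) = |x| - b := by
          rw [intervalIntegral.integral_congr (g := fun _ => (1:ℝ))]
          · simp
          · intro z hz
            rw [Set.uIcc_of_le h] at hz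
            exact hF1 z hz.1
        rw [← h3, hG, hG, intervalIntegral.integral_add_adjacent_intervals
          (hFc.intervalIntegrable _ _) (hFc.intervalIntegrable _ _)]
      have := hGm (show (0:ℝ) ≤ b by linarith)
      linarith
  · have h0 := abs_nonneg x
    constructor
    · nlinarith [hFle |x|]
    · rcases le_total |x| b with h | h
      · nlinarith [hFnn |x|]
      · rw [hF1 _ h]; linarith
end
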